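/- arXiv:1608.01827 — 2 statements merged into one kernel-verified Lean document; each statement's English description precedes it below -/
import Mathlib

section
/- Suppose Q_n ≥ 0 for every n ∈ {1,…,N} (all VOs are of type 1). Then for every permutation σ of {1,…,N}, U_0^σ = (1/2^N)·Σ_{b ∈ {0,1}^N} Ψ(b); in particular the MNO's payoff is independent of the bargaining sequence and equals the average of the social welfare over all 2^N cooperation profiles. -/
open Finset

/-- Total offloading benefit `Σ_{t<T} f_t(Σ_{n<N} b_n X_n^t)` (0-based indices). -/
noncomputable def socialOffload (T N : ℕ) (f : ℕ → ℝ → ℝ) (X : ℕ → ℕ → ℝ)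
    (b : ℕ → Bool) : ℝ :=
  ∑ t ∈ range T, f t (∑ n ∈ range N, if b n then X n t else 0)

/-- `Waux T N f X Q j b = W_{N-j}(b)`: backward recursion on the number `j` of
remaining bargaining steps.  At step `k = N - (j+1)` (0-based) the recursion is
`W_k(b) = ½·W_{k+1}(b,0) + ½·max{W_{k+1}(b,0), W_{k+1}(b,1) + Q_k}`. -/
noncomputable def Waux (T N : ℕ) (f : ℕ → ℝ → ℝ) (X : ℕ → ℕ → ℝ) (Q : ℕ → ℝ) :
    ℕ → (ℕ → Bool) → ℝ
  | 0, b => socialOffload T N f X b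
  | j + 1, b =>
      (1 / 2) * Waux T N f X Q j (Function.update b (N - (j + 1)) false)
        + (1 / 2) *
          max (Waux T N f X Q j (Function.update b (N - (j + 1)) false))
            (Waux T N f X Q j (Function.update b (N - (j + 1)) true) + Q (N - (j + 1)))

/-- The value function `W_k(b)` of the sequential one-to-many Nash bargaining
(0-based: VO `n` has parameters `Q n`, `X n ·`; `b` is the prefix of outcomes,
only its entries `0,…,k-1` matter). -/
noncomputable def W (T N : ℕ) (f : ℕ → ℝ → ℝ) (X : ℕ → ℕ → ℝ) (Q : ℕ → ℝ)
    (k : ℕ) (b : ℕ → Bool) : ℝ :=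
  Waux T N f X Q (N - k) b

/-- Parameters reindexed by a bargaining sequence `σ`: at (0-based) step `k < N`
the MNO bargains with VO `σ k`. -/
noncomputable def permQ (N : ℕ) (Q : ℕ → ℝ) (σ : Equiv.Perm (Fin N)) : ℕ → ℝ :=
  fun k => if h : k < N then Q ((σ ⟨k, h⟩ : Fin N) : ℕ) else Q k

noncomputable def permX (N : ℕ) (X : ℕ → ℕ → ℝ) (σ : Equiv.Perm (Fin N)) :
    ℕ → ℕ → ℝ :=
  fun n t => if h : n < N then X ((σ ⟨n, h⟩ : Fin N) : ℕ) t else X n t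

/-- `U_0^σ = W_0^σ`: the MNO's payoff under the bargaining sequence `σ`. -/
noncomputable def U0perm (T N : ℕ) (f : ℕ → ℝ → ℝ) (X : ℕ → ℕ → ℝ) (Q : ℕ → ℝ)
    (σ : Equiv.Perm (Fin N)) : ℝ :=
  W T N f (permX N X σ) (permQ N Q σ) 0 (fun _ => false)

/-- The social welfare `Ψ(b) = Σ_{t<T} f_t(Σ_{n<N} b_n X_n^t) + Σ_{n<N} b_n Q_n`. -/
noncomputable def Psi (T N : ℕ) (f : ℕ → ℝ → ℝ) (X : ℕ → ℕ → ℝ) (Q : ℕ → ℝ)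
    (b : ℕ → Bool) : ℝ :=
  socialOffload T N f X b + ∑ n ∈ range N, (if b n then Q n else 0)

theorem socialOffload_mono {T N : ℕ} {f : ℕ → ℝ → ℝ} {X : ℕ → ℕ → ℝ}
    (hf : ∀ t, t < T → MonotoneOn (f t) (Set.Ici (0 : ℝ)))
    (hX : ∀ n, n < N → ∀ t, t < T → 0 ≤ X n t) :
    Monotone (socialOffload T N f X) := by
  intro b c hbc
  refine sum_le_sum fun t ht => ?_
  have ht := mem_range.1 ht
  have nonneg : ∀ d : ℕ → Bool, 0 ≤ ∑ n ∈ range N, if d n then X n t else 0 := fun d =>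
    sum_nonneg fun n hn => by
      split_ifs
      exacts [hX n (mem_range.1 hn) t ht, le_rfl]
  refine hf t ht (nonneg b) (nonneg c) (sum_le_sum fun n hn => ?_)
  have hn := hX n (mem_range.1 hn) t ht
  have hle := hbc n
  cases hb : b n <;> cases hc : c n <;> simp_all [Bool.le_iff_imp]

theorem Waux_mono {T N : ℕ} {f : ℕ → ℝ → ℝ} {X : ℕ → ℕ → ℝ} (Q : ℕ → ℝ)
    (hS : Monotone (socialOffload T N f X)) (j : ℕ) : Monotone (Waux T N f X Q j) := by
  induction j with
  | zero => exact hS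
  | succ j ih =>
    intro b c hbc
    have step : ∀ x : Bool, Waux T N f X Q j (Function.update b (N - (j + 1)) x) ≤
        Waux T N f X Q j (Function.update c (N - (j + 1)) x) := fun x =>
      ih (update_le_update_iff.2 ⟨le_rfl, fun n _ => hbc n⟩)
    simp only [Waux]
    gcongr <;> exact step _

/-- When bargaining with a VO with nonnegative `Q`, the `max` in the recursion is attained by
cooperation. -/
theorem Waux_succ_of_nonneg {T N : ℕ} {f : ℕ → ℝ → ℝ} {X : ℕ → ℕ → ℝ} {Q : ℕ → ℝ}
    (hS : Monotone (socialOffload T N f X)) {j : ℕ} (hQ : 0 ≤ Q (N - (j + 1)))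
    (b : ℕ → Bool) :
    Waux T N f X Q (j + 1) b =
      (1 / 2) * (Waux T N f X Q j (Function.update b (N - (j + 1)) false) +
        (Waux T N f X Q j (Function.update b (N - (j + 1)) true) + Q (N - (j + 1)))) := by
  have hle : Waux T N f X Q j (Function.update b (N - (j + 1)) false) ≤
      Waux T N f X Q j (Function.update b (N - (j + 1)) true) :=
    Waux_mono Q hS j (update_le_update_iff.2 ⟨Bool.false_le _, fun _ _ => le_rfl⟩)
  rw [Waux, max_eq_right (by linarith), ← mul_add]

theorem two_pow_mul_Waux {T N : ℕ} {f : ℕ → ℝ → ℝ} {X : ℕ → ℕ → ℝ} {Q : ℕ → ℝ}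
    (hS : Monotone (socialOffload T N f X)) (hQ : ∀ n, n < N → 0 ≤ Q n)
    {j : ℕ} (hj : j ≤ N) (b : ℕ → Bool) :
    2 ^ j * Waux T N f X Q j b = ∑ s ∈ (Ico (N - j) N).powerset,
      (socialOffload T N f X ((Ico (N - j) N).piecewise (fun n => decide (n ∈ s)) b) +
        ∑ n ∈ s, Q n) := by
  induction j generalizing b with
  | zero =>
    have hb : (Ico N N).piecewise (fun _ => false) b = b := by ext; simp [piecewise]
    simp [Waux, hb]
  | succ j ih =>
    have hk : N - (j + 1) ∉ Ico (N - j) N := by simp; omega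
    have hI : Ico (N - (j + 1)) N = insert (N - (j + 1)) (Ico (N - j) N) := by
      ext n; simp only [mem_Ico, mem_insert]; omega
    rw [Waux_succ_of_nonneg hS (hQ _ (by omega)), hI, sum_powerset_insert hk]
    have h0 := ih (by omega) (Function.update b (N - (j + 1)) false)
    have h1 := ih (by omega) (Function.update b (N - (j + 1)) true)
    have hcard : ((Ico (N - j) N).powerset.card : ℝ) = 2 ^ j := by
      simp [card_powerset, Nat.sub_sub_self (show j ≤ N by omega)]
    have hQsum : 2 ^ j * Q (N - (j + 1)) =
        ∑ s ∈ (Ico (N - j) N).powerset, Q (N - (j + 1)) := by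
      rw [sum_const, nsmul_eq_mul, hcard]
    rw [show ∀ u v w : ℝ, 2 ^ (j + 1) * (1 / 2 * (u + (v + w))) =
      2 ^ j * u + (2 ^ j * v + 2 ^ j * w) by intros; ring, h0, h1, hQsum, ← sum_add_distrib]
    generalize N - (j + 1) = k at *
    congr 1
    · refine sum_congr rfl fun s hs => ?_
      have hks : k ∉ s := fun h => hk (mem_powerset.1 hs h)
      congr 2
      ext n
      by_cases hn : n = k
      · subst hn; simp [piecewise, hk, hks]
      · simp [piecewise, hn]
    · refine sum_congr rfl fun s hs => ?_
      have hks : k ∉ s := fun h => hk (mem_powerset.1 hs h)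
      rw [sum_insert hks, add_assoc, add_comm (∑ n ∈ s, Q n)]
      congr 2
      ext n
      by_cases hn : n = k
      · subst hn; simp [piecewise, hk]
      · simp [piecewise, hn]

theorem Psi_extend_eq {T N : ℕ} {f : ℕ → ℝ → ℝ} {X : ℕ → ℕ → ℝ} {Q : ℕ → ℝ}
    (b : Fin N → Bool) :
    Psi T N f X Q (fun n => if h : n < N then b ⟨n, h⟩ else false) =
      ∑ t ∈ range T, f t (∑ i, if b i then X i t else 0) + ∑ i, if b i then Q i else 0 := by
  simp [Psi, socialOffload, sum_range]

theorem Psi_perm {T N : ℕ} {f : ℕ → ℝ → ℝ} {X : ℕ → ℕ → ℝ} {Q : ℕ → ℝ}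
    (σ : Equiv.Perm (Fin N)) (b : Fin N → Bool) :
    Psi T N f (permX N X σ) (permQ N Q σ)
        (fun n => if h : n < N then (b ∘ σ) ⟨n, h⟩ else false) =
      Psi T N f X Q (fun n => if h : n < N then b ⟨n, h⟩ else false) := by
  rw [Psi_extend_eq, Psi_extend_eq]
  simp only [permX, permQ, Fin.is_lt, dite_true, Fin.eta, Function.comp_apply]
  rw [Equiv.sum_comp σ fun i => if b i then Q i else 0]
  congr 1
  exact sum_congr rfl fun t _ => by rw [Equiv.sum_comp σ fun i => if b i then X i t else 0]

theorem W_zero_eq_average {T N : ℕ} {f : ℕ → ℝ → ℝ} {X : ℕ → ℕ → ℝ} {Q : ℕ → ℝ}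
    (hS : Monotone (socialOffload T N f X)) (hQ : ∀ n, n < N → 0 ≤ Q n) (b : ℕ → Bool) :
    W T N f X Q 0 b = (1 / 2 ^ N) * ∑ c : Fin N → Bool,
      Psi T N f X Q (fun n => if h : n < N then c ⟨n, h⟩ else false) := by
  have hpow := two_pow_mul_Waux hS hQ le_rfl b
  rw [W, Nat.sub_zero, one_div, eq_inv_mul_iff_mul_eq₀ (by positivity), hpow]
  refine sum_bij' (fun s _ i => decide ((i : ℕ) ∈ s))
    (fun c _ => (univ.filter fun i => c i = true).map Fin.valEmbedding) ?_ ?_ ?_ ?_ ?_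
  · simp
  · intro c _
    simp only [mem_powerset, Nat.sub_self]
    intro n
    simp only [mem_map, mem_filter, mem_Ico]
    rintro ⟨i, -, rfl⟩
    simp
  · intro s hs
    have hs := mem_powerset.1 hs
    ext n
    simp only [mem_map, mem_filter, mem_univ, true_and, decide_eq_true_eq, Fin.valEmbedding_apply]
    constructor
    · rintro ⟨i, hi, rfl⟩
      exact hi
    · exact fun hn => ⟨⟨n, (mem_Ico.1 (hs hn)).2⟩, hn, rfl⟩
  · intro c _
    ext i
    simp [Fin.val_inj]
  · intro s hs
    have hs : s ⊆ range N := by simpa using hs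
    rw [Psi_extend_eq (fun i : Fin N => decide ((i : ℕ) ∈ s)), socialOffload]
    congr 1
    · refine sum_congr rfl fun t _ => ?_
      rw [sum_range]
      simp [piecewise]
    · rw [← sum_range (fun n => if decide (n ∈ s) = true then Q n else 0)]
      simp [inter_eq_right.2 hs]

/-- Theorem 3: if all VOs are of type 1 (`Q_n ≥ 0` for all `n`),
the MNO's payoff is independent of the bargaining sequence and equals
`(1/2^N)·Σ_{b ∈ {0,1}^N} Ψ(b)`. -/
theorem all_type1_payoff (T N : ℕ) (hT : 1 ≤ T) (hN : 1 ≤ N)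
    (f : ℕ → ℝ → ℝ) (X : ℕ → ℕ → ℝ) (Q : ℕ → ℝ)
    (hf : ∀ t, t < T → MonotoneOn (f t) (Set.Ici (0 : ℝ)) ∧
      ConcaveOn ℝ (Set.Ici (0 : ℝ)) (f t) ∧ f t 0 = 0)
    (hX : ∀ n, n < N → ∀ t, t < T → 0 ≤ X n t)
    (hQ : ∀ n, n < N → 0 ≤ Q n) :
    ∀ σ : Equiv.Perm (Fin N),
      U0perm T N f X Q σ =
        (1 / 2 ^ N) * ∑ b : Fin N → Bool,
          Psi T N f X Q (fun n => if h : n < N then b ⟨n, h⟩ else false) := by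
  intro σ
  have hX' : ∀ n, n < N → ∀ t, t < T → 0 ≤ permX N X σ n t := fun n hn t ht => by
    simpa [permX, hn] using hX _ (σ ⟨n, hn⟩).2 t ht
  have hQ' : ∀ n, n < N → 0 ≤ permQ N Q σ n := fun n hn => by
    simpa [permQ, hn] using hQ _ (σ ⟨n, hn⟩).2
  rw [U0perm, W_zero_eq_average (socialOffload_mono (fun t ht => (hf t ht).1) hX') hQ',
    ← Equiv.sum_comp (Equiv.arrowCongr σ.symm (Equiv.refl Bool))]
  exact congrArg _ (sum_congr rfl fun b _ => Psi_perm σ b)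
end

section
/- Suppose the VOs are homogeneous: Q_n = Q and X_n^t = X^t for all n ∈ {1,…,N} and t ∈ {1,…,T}. Then there exists a unique k ∈ {0,1,…,N} such that (a) if k ≥ 1 then Σ_{t=1}^T [f_t(k·X^t) − f_t((k−1)·X^t)] + Q ≥ 0, and (b) if k ≤ N−1 then Σ_{t=1}^T [f_t((k+1)·X^t) − f_t(k·X^t)] + Q < 0; moreover π̂_1 ≥ π̂_2 ≥ … ≥ π̂_k ≥ 0 and π̂_m = 0 for every m > k, i.e. the MNO cooperates with exactly the first k VOs and the remaining N − k VOs obtain zero payoff. -/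
open Finset

/-- `Δ_k(b) = W_{k+1}(b,1) − W_{k+1}(b,0) + Q_k` (0-based step `k`, prefix `b` of
length `k`; paper's `Δ_{k+1}`). -/
noncomputable def Delta (T N : ℕ) (f : ℕ → ℝ → ℝ) (X : ℕ → ℕ → ℝ) (Q : ℕ → ℝ)
    (k : ℕ) (b : ℕ → Bool) : ℝ :=
  W T N f X Q (k + 1) (Function.update b k true)
    - W T N f X Q (k + 1) (Function.update b k false) + Q k

/-- `bhatFn … k` is the realized outcome prefix after the first `k` bargaining
steps: `b̂_k = 1` iff `Δ_k(b̂_1,…,b̂_{k-1}) ≥ 0`. -/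
noncomputable def bhatFn (T N : ℕ) (f : ℕ → ℝ → ℝ) (X : ℕ → ℕ → ℝ) (Q : ℕ → ℝ) :
    ℕ → (ℕ → Bool)
  | 0 => fun _ => false
  | k + 1 =>
      Function.update (bhatFn T N f X Q k) k
        (if 0 ≤ Delta T N f X Q k (bhatFn T N f X Q k) then true else false)

/-- The realized payoff `π̂_k` of the VO bargaining at (0-based) step `k`. -/
noncomputable def pihat (T N : ℕ) (f : ℕ → ℝ → ℝ) (X : ℕ → ℕ → ℝ) (Q : ℕ → ℝ)
    (k : ℕ) : ℝ :=
  if 0 ≤ Delta T N f X Q k (bhatFn T N f X Q k)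
  then Delta T N f X Q k (bhatFn T N f X Q k) / 2 else 0

/-- Number of cooperating VOs among the first `m` ones. -/
def coopCount (b : ℕ → Bool) (m : ℕ) : ℕ :=
  ∑ n ∈ range m, if b n then 1 else 0

/-- Value of the bargaining with identical VOs, `j` steps before the end and with `c`
cooperating VOs so far, where `G` is the final benefit. -/
noncomputable def countValue (G : ℕ → ℝ) (q : ℝ) : ℕ → ℕ → ℝ
  | 0, c => G c
  | j + 1, c =>
      (1 / 2) * countValue G q j c
        + (1 / 2) * max (countValue G q j c) (countValue G q j (c + 1) + q)

/-- Surplus of one more cooperation, evaluated with `countValue`. -/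
noncomputable def countSurplus (G : ℕ → ℝ) (q : ℝ) (j c : ℕ) : ℝ :=
  countValue G q j (c + 1) - countValue G q j c + q

theorem countSurplus_succ (G : ℕ → ℝ) (q : ℝ) (j c : ℕ) :
    countSurplus G q (j + 1) c =
      countSurplus G q j c
        + (max 0 (countSurplus G q j (c + 1)) - max 0 (countSurplus G q j c)) / 2 := by
  have key (c : ℕ) : max (countValue G q j c) (countValue G q j (c + 1) + q)
      = countValue G q j c + max 0 (countSurplus G q j c) := by
    rw [← max_add_add_left, countSurplus]
    congr 1 <;> ring
  simp only [countSurplus, countValue] at key ⊢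
  rw [key, key]
  ring

theorem countSurplus_antitone {G : ℕ → ℝ} {q : ℝ}
    (hG : Antitone fun c => G (c + 1) - G c + q) (j : ℕ) :
    Antitone (countSurplus G q j) := by
  induction j with
  | zero => exact hG
  | succ j ih =>
    refine antitone_nat_of_succ_le fun c => ?_
    have h₀ := ih (Nat.le_succ c)
    have h₁ := ih (Nat.le_succ (c + 1))
    simp only [countSurplus_succ, Nat.succ_eq_add_one] at *
    grind

theorem countSurplus_nonneg_iff {G : ℕ → ℝ} {q : ℝ}
    (hG : Antitone fun c => G (c + 1) - G c + q) (j c : ℕ) :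
    0 ≤ countSurplus G q j c ↔ 0 ≤ G (c + 1) - G c + q := by
  induction j with
  | zero => rfl
  | succ j ih =>
    rw [← ih, countSurplus_succ]
    have h := countSurplus_antitone hG j (Nat.le_succ c)
    simp only [Nat.succ_eq_add_one] at h
    grind

theorem countSurplus_le_succ {G : ℕ → ℝ} {q : ℝ}
    (hG : Antitone fun c => G (c + 1) - G c + q) (j c : ℕ) :
    countSurplus G q j (c + 1) ≤ countSurplus G q (j + 1) c := by
  rw [countSurplus_succ]
  have h := countSurplus_antitone hG j (Nat.le_succ c)
  simp only [Nat.succ_eq_add_one] at h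
  grind

theorem coopCount_update_succ (b : ℕ → Bool) (m : ℕ) (v : Bool) :
    coopCount (Function.update b m v) (m + 1) = coopCount b m + if v then 1 else 0 := by
  unfold coopCount
  rw [sum_range_succ, Function.update_self]
  congr 1
  refine sum_congr rfl fun n hn => ?_
  rw [Function.update_of_ne (mem_range.mp hn).ne]

theorem socialOffload_eq_coopCount {T N : ℕ} {f : ℕ → ℝ → ℝ} {X : ℕ → ℕ → ℝ} {Xc : ℕ → ℝ}
    (hXh : ∀ n, n < N → ∀ t, t < T → X n t = Xc t) (b : ℕ → Bool) :
    socialOffload T N f X b = ∑ t ∈ range T, f t ((coopCount b N : ℝ) * Xc t) := by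
  refine sum_congr rfl fun t ht => ?_
  congr 1
  rw [coopCount, Nat.cast_sum, sum_mul]
  refine sum_congr rfl fun n hn => ?_
  rw [hXh n (mem_range.mp hn) t (mem_range.mp ht)]
  split_ifs <;> simp

theorem Waux_eq_countValue {T N : ℕ} {f : ℕ → ℝ → ℝ} {X : ℕ → ℕ → ℝ} {Q : ℕ → ℝ} {q : ℝ}
    {Xc : ℕ → ℝ} (hQh : ∀ n, n < N → Q n = q)
    (hXh : ∀ n, n < N → ∀ t, t < T → X n t = Xc t) {j : ℕ} (hj : j ≤ N) (b : ℕ → Bool) :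
    Waux T N f X Q j b =
      countValue (fun c => ∑ t ∈ range T, f t ((c : ℝ) * Xc t)) q j (coopCount b (N - j)) := by
  induction j generalizing b with
  | zero => exact socialOffload_eq_coopCount hXh b
  | succ j ih =>
    have hsub : N - j = N - (j + 1) + 1 := by omega
    rw [Waux, countValue, ih (by omega), ih (by omega), hsub, coopCount_update_succ,
      coopCount_update_succ, hQh _ (by omega)]
    simp

theorem Delta_eq_countSurplus {T N : ℕ} {f : ℕ → ℝ → ℝ} {X : ℕ → ℕ → ℝ} {Q : ℕ → ℝ} {q : ℝ}
    {Xc : ℕ → ℝ} (hQh : ∀ n, n < N → Q n = q)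
    (hXh : ∀ n, n < N → ∀ t, t < T → X n t = Xc t) {k : ℕ} (hk : k < N) (b : ℕ → Bool) :
    Delta T N f X Q k b =
      countSurplus (fun c => ∑ t ∈ range T, f t ((c : ℝ) * Xc t)) q (N - (k + 1))
        (coopCount b k) := by
  have hsub : N - (N - (k + 1)) = k + 1 := by omega
  rw [Delta, W, W, Waux_eq_countValue hQh hXh (Nat.sub_le _ _),
    Waux_eq_countValue hQh hXh (Nat.sub_le _ _), hsub, coopCount_update_succ,
    coopCount_update_succ, hQh k hk]
  simp [countSurplus]

theorem coopCount_bhatFn {T N : ℕ} {f : ℕ → ℝ → ℝ} {X : ℕ → ℕ → ℝ} {Q : ℕ → ℝ} {q : ℝ}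
    {Xc : ℕ → ℝ} (hQh : ∀ n, n < N → Q n = q)
    (hXh : ∀ n, n < N → ∀ t, t < T → X n t = Xc t)
    {G : ℕ → ℝ} (hGdef : G = fun c : ℕ => ∑ t ∈ range T, f t ((c : ℝ) * Xc t))
    (hG : Antitone fun c => G (c + 1) - G c + q) {K : ℕ}
    (hK : ∀ c, c < N → (0 ≤ G (c + 1) - G c + q ↔ c < K)) {k : ℕ} (hk : k ≤ N) :
    coopCount (bhatFn T N f X Q k) k = min k K := by
  induction k with
  | zero => simp [coopCount]
  | succ k ih =>
    have hDelta : 0 ≤ Delta T N f X Q k (bhatFn T N f X Q k) ↔ k < K := by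
      rw [Delta_eq_countSurplus hQh hXh (by omega), ← hGdef, countSurplus_nonneg_iff hG,
        ih (by omega), hK _ (by omega)]
      omega
    rw [bhatFn, coopCount_update_succ, ih (by omega)]
    simp only [hDelta]
    split_ifs <;> simp_all <;> omega

theorem ConcaveOn.antitone_nat_mul_increment {g : ℝ → ℝ} (hg : ConcaveOn ℝ (Set.Ici 0) g)
    {x : ℝ} (hx : 0 ≤ x) :
    Antitone fun c : ℕ => g (((c + 1 : ℕ) : ℝ) * x) - g ((c : ℝ) * x) := by
  refine antitone_nat_of_succ_le fun c => ?_
  have h := hg.2 (x := (c : ℝ) * x) (y := ((c + 1 + 1 : ℕ) : ℝ) * x)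
    (Set.mem_Ici.mpr (by positivity)) (Set.mem_Ici.mpr (by positivity))
    (show (0 : ℝ) ≤ 1 / 2 by norm_num) (show (0 : ℝ) ≤ 1 / 2 by norm_num) (by norm_num)
  have hmid : (1 / 2 : ℝ) • ((c : ℝ) * x) + (1 / 2 : ℝ) • (((c + 1 + 1 : ℕ) : ℝ) * x)
      = ((c + 1 : ℕ) : ℝ) * x := by
    push_cast [smul_eq_mul]
    ring
  rw [hmid, smul_eq_mul, smul_eq_mul] at h
  linarith

/-- Corollary 1: with homogeneous VOs (`Q_n = Q`, `X_n^t = X^t`),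
there is a unique threshold `k ∈ {0,…,N}` satisfying the two marginal
inequalities; the MNO cooperates with exactly the first `k` VOs, whose payoffs
satisfy `π̂_1 ≥ … ≥ π̂_k ≥ 0`, and the remaining `N − k` VOs get zero payoff. -/
theorem homogeneous_cooperation_threshold (T N : ℕ) (hT : 1 ≤ T) (hN : 1 ≤ N)
    (f : ℕ → ℝ → ℝ) (X : ℕ → ℕ → ℝ) (Q : ℕ → ℝ) (Qc : ℝ) (Xc : ℕ → ℝ)
    (hf : ∀ t, t < T → MonotoneOn (f t) (Set.Ici (0 : ℝ)) ∧
      ConcaveOn ℝ (Set.Ici (0 : ℝ)) (f t) ∧ f t 0 = 0)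
    (hX : ∀ n, n < N → ∀ t, t < T → 0 ≤ X n t)
    (hQh : ∀ n, n < N → Q n = Qc)
    (hXh : ∀ n, n < N → ∀ t, t < T → X n t = Xc t) :
    let P : ℕ → Prop := fun k => k ≤ N ∧
      (1 ≤ k → 0 ≤ (∑ t ∈ range T,
        (f t ((k : ℝ) * Xc t) - f t (((k - 1 : ℕ) : ℝ) * Xc t))) + Qc) ∧
      (k < N → (∑ t ∈ range T,
        (f t (((k + 1 : ℕ) : ℝ) * Xc t) - f t ((k : ℝ) * Xc t))) + Qc < 0)
    (∃! k : ℕ, P k) ∧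
      ∀ k : ℕ, P k →
        (∀ i j, i ≤ j → j < k → pihat T N f X Q j ≤ pihat T N f X Q i) ∧
        (∀ j, j < k → 0 ≤ pihat T N f X Q j) ∧
        (∀ m, k ≤ m → m < N → pihat T N f X Q m = 0) := by
  intro P
  set G : ℕ → ℝ := fun c => ∑ t ∈ range T, f t ((c : ℝ) * Xc t) with hGdef
  have hXc : ∀ t, t < T → 0 ≤ Xc t := fun t ht => hXh 0 hN t ht ▸ hX 0 hN t ht
  have hG : Antitone fun c => G (c + 1) - G c + Qc := by
    intro a b hab
    simp only [hGdef, ← sum_sub_distrib]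
    refine add_le_add_left (sum_le_sum fun t ht => ?_) Qc
    have ht' := mem_range.mp ht
    exact (hf t ht').2.1.antitone_nat_mul_increment (hXc t ht') hab
  have hP : ∀ k, P k ↔ k ≤ N ∧ ∀ c, c < N → (0 ≤ G (c + 1) - G c + Qc ↔ c < k) := by
    intro k
    simp only [P, sum_sub_distrib]
    refine and_congr_right fun hkN => ⟨fun ⟨h₁, h₂⟩ c hc => ⟨fun h => ?_, fun h => ?_⟩,
      fun h => ⟨fun hk => ?_, fun hk => ?_⟩⟩
    · by_contra! hkc
      exact absurd (h.trans (hG hkc)) (not_le.mpr (h₂ (hkc.trans_lt hc)))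
    · obtain ⟨k, rfl⟩ : ∃ l, k = l + 1 := ⟨k - 1, by omega⟩
      exact le_trans (h₁ (by omega)) (hG (show c ≤ k by omega))
    · obtain ⟨k, rfl⟩ : ∃ l, k = l + 1 := ⟨k - 1, by omega⟩
      exact (h k (by omega)).mpr (by omega)
    · exact not_le.mp fun h' => lt_irrefl k ((h k hk).mp h')
  refine ⟨?_, fun k hk => ?_⟩
  · have hex : ∃ k, N ≤ k ∨ G (k + 1) - G k + Qc < 0 := ⟨N, Or.inl le_rfl⟩
    classical
    refine ⟨Nat.find hex, (hP _).mpr ⟨Nat.find_min' hex (Or.inl le_rfl), fun c hc => ?_⟩,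
      fun k hk => ?_⟩
    · refine ⟨fun h => ?_, fun h => ?_⟩
      · by_contra! hle
        rcases Nat.find_spec hex with h' | h'
        · omega
        · exact absurd (h.trans (hG hle)) (not_le.mpr h')
      · have := Nat.find_min hex h
        push Not at this
        exact this.2
    · obtain ⟨hkN, hk⟩ := (hP k).mp hk
      refine ((Nat.find_eq_iff hex).mpr ⟨?_, fun c hc => ?_⟩).symm
      · rcases hkN.eq_or_lt with rfl | hlt
        · exact Or.inl le_rfl
        · exact Or.inr (not_le.mp fun h => lt_irrefl k ((hk k hlt).mp h))
      · push Not
        exact ⟨by omega, (hk c (by omega)).mpr hc⟩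
  · obtain ⟨hkN, hk⟩ := (hP k).mp hk
    have hDelta : ∀ m, m < N → Delta T N f X Q m (bhatFn T N f X Q m) =
        countSurplus G Qc (N - (m + 1)) (min m k) := fun m hm => by
      rw [Delta_eq_countSurplus hQh hXh hm, coopCount_bhatFn hQh hXh hGdef hG hk hm.le]
    have hsign : ∀ m, m < N → (0 ≤ countSurplus G Qc (N - (m + 1)) (min m k) ↔ m < k) :=
      fun m hm => by
        rw [countSurplus_nonneg_iff hG, hk _ (by omega)]
        omega
    have hcoop : ∀ m, m < k → pihat T N f X Q m = countSurplus G Qc (N - (m + 1)) m / 2 :=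
      fun m hm => by
        rw [pihat, hDelta m (by omega), if_pos ((hsign m (by omega)).mpr hm), min_eq_left hm.le]
    refine ⟨fun i j hij hjk => ?_, fun j hj => ?_, fun m hkm hm => ?_⟩
    · induction j, hij using Nat.le_induction with
      | base => exact le_rfl
      | succ j _ ih =>
        refine le_trans ?_ (ih (by omega))
        rw [hcoop j (by omega), hcoop (j + 1) hjk,
          show N - (j + 1) = N - (j + 1 + 1) + 1 by omega]
        gcongr
        exact countSurplus_le_succ hG _ _
    · have := (hsign j (by omega)).mpr hj
      rw [min_eq_left hj.le] at this
      rw [hcoop j hj]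
      positivity
    · rw [pihat, hDelta m hm, if_neg fun h => absurd ((hsign m hm).mp h) (by omega)]
end
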